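/- Let N ≥ 1, t > 0, and let v ∈ ℝ^N have pairwise distinct coordinates. Then the gradient condition ∑_{j≠i} 2/(v_i − v_j) = v_i/t for all i = 1,…,N (i.e. the vanishing of all first partial derivatives of v ↦ F_N(v,t)) holds if and only if v = √(2t)·ρz for some permutation ρ ∈ S_N, where z ∈ ℝ^N is the strictly increasing vector of the N roots of the physicist's Hermite polynomial H_N. -/

import Mathlib

open Real

/-- Physicist's Hermite polynomials: `H 0 = 1`, `H 1 = 2x`,
`H (n+2) = 2x * H (n+1) - 2(n+1) * H n`. -/
noncomputable def physHermite : ℕ → Polynomial ℝ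
  | 0 => 1
  | 1 => Polynomial.C 2 * Polynomial.X
  | (n + 2) => Polynomial.C 2 * Polynomial.X * physHermite (n + 1)
      - Polynomial.C (2 * ((n : ℝ) + 1)) * physHermite n

/-- The function
`F_N(v,t) = (N/2)(N−1)(1 − log t) − ∑_{j=1}^N j log j + 2 log|h_N(v)| − |v|²/(2t)`,
where `h_N(v) = ∏_{i<j} (v_j − v_i)` is the Vandermonde determinant. -/
noncomputable def FN (N : ℕ) (v : Fin N → ℝ) (t : ℝ) : ℝ :=
  ((N : ℝ) / 2) * ((N : ℝ) - 1) * (1 - Real.log t)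
    - ∑ j ∈ Finset.Icc 1 N, (j : ℝ) * Real.log j
    + 2 * Real.log |∏ i : Fin N, ∏ j ∈ Finset.Ioi i, (v j - v i)|
    - (∑ i, v i ^ 2) / (2 * t)

open Polynomial in
/-- The Hermite differential operator `P ↦ P'' - 2 x P' + 2 n P`. -/
noncomputable def hermiteOp (n : ℕ) (P : Polynomial ℝ) : Polynomial ℝ :=
  derivative (derivative P) - C 2 * X * derivative P + C (2 * (n : ℝ)) * P

section HermiteOp

open Polynomial

theorem hermiteOp_sub (n : ℕ) (P Q : ℝ[X]) :
    hermiteOp n (P - Q) = hermiteOp n P - hermiteOp n Q := by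
  simp only [hermiteOp, derivative_sub]
  ring

theorem hermiteOp_C_mul (n : ℕ) (a : ℝ) (P : ℝ[X]) :
    hermiteOp n (C a * P) = C a * hermiteOp n P := by
  simp only [hermiteOp, derivative_C_mul]
  ring

theorem coeff_hermiteOp (n : ℕ) (P : ℝ[X]) (k : ℕ) :
    (hermiteOp n P).coeff k =
      (k + 2) * (k + 1) * P.coeff (k + 2) + 2 * ((n : ℝ) - k) * P.coeff k := by
  have h : (X * derivative P).coeff k = k * P.coeff k := by
    cases k with
    | zero => simp
    | succ k => rw [coeff_X_mul, coeff_derivative]; push_cast; ring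
  rw [hermiteOp, coeff_add, coeff_sub, mul_assoc, coeff_C_mul, coeff_C_mul, h, coeff_derivative,
    coeff_derivative]
  push_cast
  ring

theorem eq_zero_of_hermiteOp_eq_zero {n : ℕ} {P : ℝ[X]} (hP : hermiteOp n P = 0)
    (hn : P.coeff n = 0) : P = 0 := by
  by_contra h0
  have h := coeff_hermiteOp n P P.natDegree
  rw [hP, coeff_eq_zero_of_natDegree_lt (n := P.natDegree + 2) (by omega)] at h
  have hlead : P.coeff P.natDegree ≠ 0 := by simpa using h0
  have hne : (n : ℝ) - P.natDegree ≠ 0 := by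
    rw [sub_ne_zero, Ne, Nat.cast_inj]
    intro hdeg
    exact hlead (hdeg ▸ hn)
  simp [hne, h0] at h

theorem natDegree_physHermite_le (n : ℕ) : (physHermite n).natDegree ≤ n := by
  induction n using Nat.twoStepInduction with
  | zero => simp [physHermite]
  | one => rw [physHermite]; compute_degree
  | more n ih₀ ih₁ =>
    rw [physHermite, mul_assoc]
    refine (natDegree_sub_le _ _).trans (max_le ?_ ?_)
    · refine (natDegree_C_mul_le _ _).trans (natDegree_mul_le.trans ?_)
      rw [natDegree_X]
      omega
    · exact (natDegree_C_mul_le _ _).trans (by omega)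

theorem coeff_physHermite_self (n : ℕ) : (physHermite n).coeff n = 2 ^ n := by
  induction n using Nat.twoStepInduction with
  | zero => simp [physHermite]
  | one => simp [physHermite]
  | more n ih₀ ih₁ =>
    have h : (physHermite n).coeff (n + 2) = 0 :=
      coeff_eq_zero_of_natDegree_lt (by have := natDegree_physHermite_le n; omega)
    rw [physHermite, coeff_sub, mul_assoc, coeff_C_mul, coeff_C_mul, coeff_X_mul, ih₁, h]
    ring

theorem derivative_physHermite_succ (n : ℕ) :
    derivative (physHermite (n + 1)) = C (2 * ((n : ℝ) + 1)) * physHermite n := by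
  induction n using Nat.twoStepInduction with
  | zero => simp [physHermite]
  | one =>
    simp only [physHermite, derivative_sub, derivative_mul, derivative_ofNat,
      derivative_X, derivative_one, Nat.cast_zero, map_mul, map_add, map_zero,
      map_one, map_natCast, map_ofNat]
    push_cast
    ring
  | more n ih₀ ih₁ =>
    rw [physHermite, derivative_sub, mul_assoc, derivative_C_mul, derivative_C_mul, derivative_mul,
      derivative_X, ih₁, ih₀, show n + 2 = n + 1 + 1 from rfl, physHermite]
    simp only [map_mul, map_add, map_one, map_natCast, map_ofNat, Nat.cast_add, Nat.cast_one]
    ring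

theorem physHermite_succ (n : ℕ) :
    physHermite (n + 1) = C 2 * X * physHermite n - derivative (physHermite n) := by
  cases n with
  | zero => simp [physHermite]
  | succ n => rw [derivative_physHermite_succ, physHermite]

theorem hermiteOp_physHermite (n : ℕ) : hermiteOp n (physHermite n) = 0 := by
  have h := derivative_physHermite_succ n
  rw [physHermite_succ, derivative_sub, mul_assoc, derivative_C_mul, derivative_mul,
    derivative_X] at h
  simp only [map_mul, map_add, map_one, map_natCast, map_ofNat] at h
  simp only [hermiteOp, map_mul, map_natCast, map_ofNat]
  linear_combination -h

variable {ι : Type*} [Fintype ι]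

theorem coeff_prod_X_sub_C_card (y : ι → ℝ) :
    (∏ i, (X - C (y i))).coeff (Fintype.card ι) = 1 := by
  have h := (monic_prod_X_sub_C y Finset.univ).coeff_natDegree
  rwa [natDegree_finsetProd_X_sub_C_eq_card] at h

theorem natDegree_prod_X_sub_C_card (y : ι → ℝ) :
    (∏ i, (X - C (y i))).natDegree = Fintype.card ι :=
  natDegree_finsetProd_X_sub_C_eq_card _ _

theorem eq_zero_of_coeff_card_eq_zero_of_roots {y : ι → ℝ} (hy : Function.Injective y) {P : ℝ[X]}
    (hdeg : P.natDegree ≤ Fintype.card ι) (hcoeff : P.coeff (Fintype.card ι) = 0)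
    (hroot : ∀ i, P.eval (y i) = 0) : P = 0 := by
  by_contra h0
  refine h0 (eq_zero_of_natDegree_lt_card_of_eval_eq_zero P hy hroot (hdeg.lt_of_ne ?_))
  intro h
  rw [← h] at hcoeff
  exact h0 (leadingCoeff_eq_zero.mp hcoeff)

theorem eval_hermiteOp_prod_X_sub_C [DecidableEq ι] {y : ι → ℝ} (hy : Function.Injective y)
    (n : ℕ) (i : ι) :
    (hermiteOp n (∏ j, (X - C (y j)))).eval (y i) =
      2 * (∏ j ∈ Finset.univ.erase i, (y i - y j)) *
        (∑ j ∈ Finset.univ.erase i, 1 / (y i - y j) - y i) := by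
  rw [← Finset.mul_prod_erase _ _ (Finset.mem_univ i)]
  set R := ∏ j ∈ Finset.univ.erase i, (X - C (y j)) with hR
  have hR₀ : R.eval (y i) = ∏ j ∈ Finset.univ.erase i, (y i - y j) := by
    simp [hR, eval_prod]
  have hR₁ : (derivative R).eval (y i) =
      R.eval (y i) * ∑ j ∈ Finset.univ.erase i, 1 / (y i - y j) := by
    rw [hR₀, hR, derivative_prod_finset, eval_finsetSum, Finset.mul_sum]
    refine Finset.sum_congr rfl fun j hj => ?_
    have hne : y i - y j ≠ 0 := sub_ne_zero.mpr (hy.ne (Finset.ne_of_mem_erase hj).symm)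
    rw [← Finset.mul_prod_erase _ _ hj]
    simp only [derivative_X_sub_C, mul_one, eval_prod, eval_sub, eval_X, eval_C]
    field_simp
  simp only [hermiteOp, derivative_mul, derivative_add, derivative_X_sub_C, eval_add, eval_sub,
    eval_mul, eval_X, eval_C, one_mul, sub_self, zero_mul, hR₁, hR₀]
  ring

theorem hermiteOp_prod_X_sub_C_eq_zero_iff [DecidableEq ι] {y : ι → ℝ}
    (hy : Function.Injective y) :
    hermiteOp (Fintype.card ι) (∏ j, (X - C (y j))) = 0 ↔
      ∀ i, ∑ j ∈ Finset.univ.erase i, 1 / (y i - y j) = y i := by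
  have hne (i : ι) : ∏ j ∈ Finset.univ.erase i, (y i - y j) ≠ 0 :=
    Finset.prod_ne_zero_iff.mpr fun j hj =>
      sub_ne_zero.mpr (hy.ne (Finset.ne_of_mem_erase hj).symm)
  constructor
  · intro h i
    have hi := eval_hermiteOp_prod_X_sub_C hy (Fintype.card ι) i
    rw [h, eval_zero, eq_comm] at hi
    simpa [hne i, sub_eq_zero] using hi
  · intro h
    have hdeg := natDegree_prod_X_sub_C_card y
    refine eq_zero_of_coeff_card_eq_zero_of_roots hy ?_ ?_ fun i => ?_
    · rw [natDegree_le_iff_coeff_eq_zero]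
      intro k hk
      rw [coeff_hermiteOp, coeff_eq_zero_of_natDegree_lt (n := k + 2) (by omega),
        coeff_eq_zero_of_natDegree_lt (n := k) (by omega)]
      ring
    · rw [coeff_hermiteOp, coeff_eq_zero_of_natDegree_lt (n := Fintype.card ι + 2) (by omega)]
      ring
    · rw [eval_hermiteOp_prod_X_sub_C hy, h i, sub_self, mul_zero]

theorem physHermite_eq_of_roots {y : ι → ℝ} (hy : Function.Injective y)
    (hroot : ∀ i, (physHermite (Fintype.card ι)).eval (y i) = 0) :
    physHermite (Fintype.card ι) = C (2 ^ Fintype.card ι) * ∏ i, (X - C (y i)) := by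
  rw [← sub_eq_zero]
  refine eq_zero_of_coeff_card_eq_zero_of_roots hy ?_ ?_ fun i => ?_
  · refine (natDegree_sub_le _ _).trans (max_le (natDegree_physHermite_le _) ?_)
    exact (natDegree_C_mul_le _ _).trans (natDegree_prod_X_sub_C_card y).le
  · rw [coeff_sub, coeff_C_mul, coeff_physHermite_self, coeff_prod_X_sub_C_card, mul_one, sub_self]
  · rw [eval_sub, hroot, eval_mul, eval_prod, Finset.prod_eq_zero (Finset.mem_univ i) (by simp)]
    simp

theorem physHermite_eq_of_hermiteOp_eq_zero {y : ι → ℝ}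
    (h : hermiteOp (Fintype.card ι) (∏ i, (X - C (y i))) = 0) :
    physHermite (Fintype.card ι) = C (2 ^ Fintype.card ι) * ∏ i, (X - C (y i)) := by
  rw [← sub_eq_zero]
  refine eq_zero_of_hermiteOp_eq_zero (n := Fintype.card ι) ?_ ?_
  · rw [hermiteOp_sub, hermiteOp_C_mul, h, hermiteOp_physHermite, mul_zero, sub_zero]
  · rw [coeff_sub, coeff_C_mul, coeff_physHermite_self, coeff_prod_X_sub_C_card, mul_one, sub_self]

/-- Stieltjes' characterization of the zeros of the Hermite polynomials. -/
theorem forall_sum_inv_sub_eq_iff_physHermite_roots [DecidableEq ι] {y : ι → ℝ}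
    (hy : Function.Injective y) :
    (∀ i, ∑ j ∈ Finset.univ.erase i, 1 / (y i - y j) = y i) ↔
      physHermite (Fintype.card ι) = C (2 ^ Fintype.card ι) * ∏ i, (X - C (y i)) := by
  rw [← hermiteOp_prod_X_sub_C_eq_zero_iff hy]
  refine ⟨physHermite_eq_of_hermiteOp_eq_zero, fun h => ?_⟩
  have h' := hermiteOp_physHermite (Fintype.card ι)
  rw [h, hermiteOp_C_mul] at h'
  simpa using h'

end HermiteOp

/-- The gradient of `v ↦ F_N(v,t)` vanishes at `v` (equivalently,
`∑_{j≠i} 2/(v_i − v_j) = v_i/t` for all `i`) if and only if `v = √(2t)·ρz` for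
some permutation `ρ`, where `z` is the increasing vector of roots of `H_N`. -/
theorem stmt_3 (N : ℕ) (hN : 1 ≤ N) (t : ℝ) (ht : 0 < t)
    (v : Fin N → ℝ) (hv : Function.Injective v)
    (z : Fin N → ℝ) (hz : StrictMono z)
    (hroot : ∀ i, (physHermite N).eval (z i) = 0) :
    (∀ i, ∑ j ∈ Finset.univ.erase i, 2 / (v i - v j) = v i / t)
      ↔ ∃ ρ : Equiv.Perm (Fin N), v = fun j => Real.sqrt (2 * t) * z (ρ j) := by
  have hs : 0 < √(2 * t) := Real.sqrt_pos.mpr (by positivity)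
  have hs2 : √(2 * t) ^ 2 = 2 * t := Real.sq_sqrt (by positivity)
  obtain ⟨y, rfl⟩ : ∃ y : Fin N → ℝ, v = fun i => √(2 * t) * y i :=
    ⟨fun i => v i / √(2 * t), by ext i; field_simp⟩
  have hy : Function.Injective y := fun i j h => hv (by simp [h])
  have hgrad (i : Fin N) :
      (∑ j ∈ Finset.univ.erase i, 2 / (√(2 * t) * y i - √(2 * t) * y j) = √(2 * t) * y i / t) ↔
        ∑ j ∈ Finset.univ.erase i, 1 / (y i - y j) = y i := by
    have hsum : ∑ j ∈ Finset.univ.erase i, 2 / (√(2 * t) * y i - √(2 * t) * y j) =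
        2 / √(2 * t) * ∑ j ∈ Finset.univ.erase i, 1 / (y i - y j) := by
      rw [Finset.mul_sum]
      exact Finset.sum_congr rfl fun j _ => by rw [← mul_sub, div_mul_div_comm, mul_one]
    have hrhs : √(2 * t) * y i / t = 2 / √(2 * t) * y i := by
      field_simp
      linear_combination y i * hs2
    rw [hsum, hrhs]
    exact mul_right_inj' (by positivity)
  have hH := forall_sum_inv_sub_eq_iff_physHermite_roots hy
  have hz' := physHermite_eq_of_roots hz.injective (by simpa using hroot)
  simp only [Fintype.card_fin] at hH hz'
  simp only [hgrad, hH]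
  constructor
  · intro h
    have hmem (i : Fin N) : ∃ j, z i = y j := by
      have hi := hroot i
      rw [h] at hi
      simpa [Polynomial.eval_prod, Finset.prod_eq_zero_iff, sub_eq_zero] using hi
    choose σ hσ using hmem
    have hσ_inj : Function.Injective σ := fun i j hij => hz.injective (by rw [hσ, hσ, hij])
    let e := Equiv.ofBijective σ (Finite.injective_iff_bijective.mp hσ_inj)
    refine ⟨e.symm, funext fun j => ?_⟩
    rw [hσ]
    exact congrArg (√(2 * t) * y ·) (e.apply_symm_apply j).symm
  · rintro ⟨ρ, hρ⟩
    have hyz (j : Fin N) : y j = z (ρ j) := mul_left_cancel₀ hs.ne' (congrFun hρ j)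
    simp only [hz', hyz]
    rw [Equiv.prod_comp ρ fun i => Polynomial.X - Polynomial.C (z i)]
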